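/- arXiv:2404.18822 — 12 statements merged into one kernel-verified Lean document; each statement's English description precedes it below -/
import Mathlib

section
/- Let ρ be the multivariate Gaussian measure on ℝ^N × ℝ^K with mean vector (μ, Pμ) and (positive definite) block covariance matrix [[Σ, ΣPᵀ], [PΣ, PΣPᵀ + Ω]], and let r and Y denote the two coordinate projections. Then for ρ-almost every y, the conditional distribution of r given Y = y is the multivariate Gaussian measure on ℝ^N with mean μ_BL(y) = (Σ⁻¹ + PᵀΩ⁻¹P)⁻¹(Σ⁻¹μ + PᵀΩ⁻¹y) and covariance Σ_BL = (Σ⁻¹ + PᵀΩ⁻¹P)⁻¹. -/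
open Matrix MeasureTheory ProbabilityTheory
open scoped Matrix ENNReal

/-- The multivariate Gaussian measure on `ℝ^n` with mean `m` and
(positive definite) covariance matrix `C`, given by its density with respect
to Lebesgue measure. -/
noncomputable def gaussianPi {n : ℕ} (m : Fin n → ℝ)
    (C : Matrix (Fin n) (Fin n) ℝ) : Measure (Fin n → ℝ) :=
  volume.withDensity fun x =>
    ENNReal.ofReal ((Real.sqrt ((2 * Real.pi) ^ n * C.det))⁻¹ *
      Real.exp (-(1 / 2) * ((x - m) ⬝ᵥ (C⁻¹ *ᵥ (x - m)))))

/-- The multivariate Gaussian measure on `ℝ^N × ℝ^K` with mean vector `(μ, Pμ)`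
and block covariance matrix `[[Σ, ΣPᵀ], [PΣ, PΣPᵀ + Ω]]`. -/
noncomputable def blJointGaussian (N K : ℕ) (μ : Fin N → ℝ)
    (S : Matrix (Fin N) (Fin N) ℝ) (Ω : Matrix (Fin K) (Fin K) ℝ)
    (P : Matrix (Fin K) (Fin N) ℝ) : Measure ((Fin N → ℝ) × (Fin K → ℝ)) :=
  (volume : Measure ((Fin N → ℝ) × (Fin K → ℝ))).withDensity fun p =>
    ENNReal.ofReal
      ((Real.sqrt ((2 * Real.pi) ^ (N + K) *
          (Matrix.fromBlocks S (S * Pᵀ) (P * S) (P * S * Pᵀ + Ω)).det))⁻¹ *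
        Real.exp (-(1 / 2) *
          (Sum.elim (p.1 - μ) (p.2 - P *ᵥ μ) ⬝ᵥ
            ((Matrix.fromBlocks S (S * Pᵀ) (P * S) (P * S * Pᵀ + Ω))⁻¹ *ᵥ
              Sum.elim (p.1 - μ) (p.2 - P *ᵥ μ)))))

lemma bl_std (n : ℕ) :
    ∫⁻ x : Fin n → ℝ, ENNReal.ofReal (Real.exp (-(1 / 2) * (x ⬝ᵥ x))) =
      ENNReal.ofReal (Real.sqrt ((2 * Real.pi) ^ n)) := by
  have h1 : ∀ x : Fin n → ℝ, Real.exp (-(1 / 2) * (x ⬝ᵥ x)) =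
      ∏ i, Real.exp (-(1 / 2) * (x i) ^ 2) := by
    intro x
    rw [← Real.exp_sum, dotProduct, Finset.mul_sum]
    simp only [pow_two]
  simp only [h1]
  have hi : Integrable (fun x : ℝ => Real.exp (-(1 / 2) * x ^ 2)) :=
    integrable_exp_neg_mul_sq (by norm_num)
  rw [← ofReal_integral_eq_lintegral_ofReal]
  · rw [integral_fintype_prod_volume_eq_prod (fun (_ : Fin n) (x : ℝ) => Real.exp (-(1 / 2) * x ^ 2))]
    rw [integral_gaussian]
    congr 1
    rw [Finset.prod_const, Finset.card_univ, Fintype.card_fin]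
    have e : Real.pi / (1 / 2) = 2 * Real.pi := by ring
    rw [e]
    symm
    rw [Real.sqrt_eq_iff_mul_self_eq (by positivity) (by positivity), ← mul_pow,
      Real.mul_self_sqrt (by positivity)]
  · exact Integrable.fintype_prod (f := fun (_ : Fin n) (x : ℝ) => Real.exp (-(1 / 2) * x ^ 2))
      (fun _ => hi)
  · exact Filter.Eventually.of_forall fun x => Finset.prod_nonneg fun i _ => (Real.exp_pos _).le

open scoped MatrixOrder in
lemma bl_factor {n : ℕ} {M : Matrix (Fin n) (Fin n) ℝ} (hM : M.PosDef) :
    ∃ B : Matrix (Fin n) (Fin n) ℝ, M = Bᵀ * B ∧ B.det ≠ 0 := by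
  obtain ⟨y, hy, h⟩ := CStarAlgebra.isStrictlyPositive_iff_eq_star_mul_self.mp
        hM.isStrictlyPositive
  refine ⟨y, ?_, ?_⟩
  · rw [h, star_eq_conjTranspose, conjTranspose_eq_transpose_of_trivial]
  · exact ((Matrix.isUnit_iff_isUnit_det _).1 hy).ne_zero

lemma bl_norm {n : ℕ} (m : Fin n → ℝ) {M : Matrix (Fin n) (Fin n) ℝ} (hM : M.PosDef) :
    ∫⁻ x : Fin n → ℝ, ENNReal.ofReal ((Real.sqrt ((2 * Real.pi) ^ n * (M⁻¹).det))⁻¹ *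
      Real.exp (-(1 / 2) * ((x - m) ⬝ᵥ (M *ᵥ (x - m))))) = 1 := by
  obtain ⟨B, hB, hd⟩ := bl_factor hM
  have hc : 0 ≤ (Real.sqrt ((2 * Real.pi) ^ n * (M⁻¹).det))⁻¹ := by positivity
  simp_rw [ENNReal.ofReal_mul hc]
  rw [lintegral_const_mul' _ _ ENNReal.ofReal_ne_top]
  rw [lintegral_sub_right_eq_self
    (fun x : Fin n → ℝ => ENNReal.ofReal (Real.exp (-(1 / 2) * (x ⬝ᵥ (M *ᵥ x))))) m]
  have h1 : ∀ x : Fin n → ℝ, x ⬝ᵥ (M *ᵥ x) = (toLin' B x) ⬝ᵥ (toLin' B x) := by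
    intro x
    rw [hB, toLin'_apply, ← mulVec_mulVec, dotProduct_mulVec, vecMul_transpose]
  simp_rw [h1]
  have hmeas : Measurable (toLin' B) := (LinearMap.continuous_of_finiteDimensional _).measurable
  have hF : Measurable fun z : Fin n → ℝ => ENNReal.ofReal (Real.exp (-(1 / 2) * (z ⬝ᵥ z))) := by
    unfold dotProduct; fun_prop
  rw [← lintegral_map (f := fun z : Fin n → ℝ => ENNReal.ofReal (Real.exp (-(1 / 2) * (z ⬝ᵥ z))))
    hF hmeas, Real.map_matrix_volume_pi_eq_smul_volume_pi hd, lintegral_smul_measure, bl_std,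
    smul_eq_mul, ← ENNReal.ofReal_mul (abs_nonneg _), ← ENNReal.ofReal_mul hc, ← ENNReal.ofReal_one]
  congr 1
  rw [det_nonsing_inv, hB, det_mul, det_transpose, Ring.inverse_eq_inv', Real.sqrt_mul (by positivity),
    Real.sqrt_inv, Real.sqrt_mul_self_eq_abs, abs_inv]
  have : 0 < |B.det| := abs_pos.2 hd
  have : 0 < Real.sqrt ((2 * Real.pi) ^ n) := by positivity
  field_simp

lemma bl_inv {N K : ℕ} {S : Matrix (Fin N) (Fin N) ℝ} {Ω : Matrix (Fin K) (Fin K) ℝ}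
    (P : Matrix (Fin K) (Fin N) ℝ) (hS : S.PosDef) (hΩ : Ω.PosDef) :
    (Matrix.fromBlocks S (S * Pᵀ) (P * S) (P * S * Pᵀ + Ω))⁻¹ =
      Matrix.fromBlocks (S⁻¹ + Pᵀ * Ω⁻¹ * P) (-(Pᵀ * Ω⁻¹)) (-(Ω⁻¹ * P)) Ω⁻¹ := by
  have hS1 : S * S⁻¹ = 1 := Matrix.mul_nonsing_inv _ ((Matrix.isUnit_iff_isUnit_det _).1 hS.isUnit)
  have hO1 : Ω * Ω⁻¹ = 1 := Matrix.mul_nonsing_inv _ ((Matrix.isUnit_iff_isUnit_det _).1 hΩ.isUnit)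
  apply Matrix.inv_eq_right_inv
  rw [fromBlocks_multiply, ← fromBlocks_one]
  have e1 : ∀ X : Matrix (Fin K) (Fin N) ℝ, Ω * (Ω⁻¹ * X) = X := fun X => by
    rw [← Matrix.mul_assoc, hO1, Matrix.one_mul]
  congr 1
  · simp only [Matrix.mul_add, Matrix.mul_neg, hS1, Matrix.mul_assoc]; abel
  · simp only [Matrix.mul_neg, Matrix.mul_assoc]; abel
  · simp only [Matrix.mul_add, Matrix.add_mul, Matrix.mul_neg, hS1, Matrix.mul_assoc, e1, Matrix.mul_one]; abel
  · simp only [Matrix.add_mul, Matrix.mul_neg, hO1, Matrix.mul_assoc]; abel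

lemma bl_quad {N K : ℕ} (μ : Fin N → ℝ) {S : Matrix (Fin N) (Fin N) ℝ}
    {Ω : Matrix (Fin K) (Fin K) ℝ}
    (P : Matrix (Fin K) (Fin N) ℝ) (hS : S.PosDef) (hΩ : Ω.PosDef)
    (hM : (S⁻¹ + Pᵀ * Ω⁻¹ * P).PosDef) (x : Fin N → ℝ) (y : Fin K → ℝ) :
    let M := S⁻¹ + Pᵀ * Ω⁻¹ * P
    let v := y - P *ᵥ μ
    let w := M⁻¹ *ᵥ ((Pᵀ * Ω⁻¹) *ᵥ v)
    let m := M⁻¹ *ᵥ (S⁻¹ *ᵥ μ + (Pᵀ * Ω⁻¹) *ᵥ y)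
    (Sum.elim (x - μ) v ⬝ᵥ
            ((Matrix.fromBlocks S (S * Pᵀ) (P * S) (P * S * Pᵀ + Ω))⁻¹ *ᵥ
              Sum.elim (x - μ) v)) =
    (x - m) ⬝ᵥ (M *ᵥ (x - m)) + (v ⬝ᵥ (Ω⁻¹ *ᵥ v) - w ⬝ᵥ (M *ᵥ w)) := by
  intro M v w m
  have hMi : M⁻¹ * M = 1 := Matrix.nonsing_inv_mul _ ((Matrix.isUnit_iff_isUnit_det _).1 hM.isUnit)
  have hMi' : M * M⁻¹ = 1 := Matrix.mul_nonsing_inv _ ((Matrix.isUnit_iff_isUnit_det _).1 hM.isUnit)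
  have hm : m = μ + w := by
    have : S⁻¹ *ᵥ μ + (Pᵀ * Ω⁻¹) *ᵥ y = M *ᵥ μ + (Pᵀ * Ω⁻¹) *ᵥ v := by
      simp only [M, v, add_mulVec, mulVec_sub, ← mulVec_mulVec]; abel
    simp only [m, w]
    rw [this, mulVec_add, mulVec_mulVec, hMi, one_mulVec]
  have hMw : M *ᵥ w = (Pᵀ * Ω⁻¹) *ᵥ v := by
    simp only [w]; rw [mulVec_mulVec, hMi', one_mulVec]
  have hMt : Mᵀ = M := by
    rw [← conjTranspose_eq_transpose_of_trivial]; exact hM.isHermitian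
  have hOt : (Ω⁻¹)ᵀ = Ω⁻¹ := by
    rw [← conjTranspose_eq_transpose_of_trivial]; exact hΩ.inv.isHermitian
  rw [bl_inv P hS hΩ, fromBlocks_mulVec]
  have hxm : x - m = (x - μ) - w := by rw [hm]; abel
  rw [hxm]
  generalize x - μ = u
  have hs : w ⬝ᵥ (M *ᵥ u) = u ⬝ᵥ (M *ᵥ w) := by
    rw [dotProduct_mulVec, ← mulVec_transpose, hMt, dotProduct_comm]
  have hs2 : v ⬝ᵥ ((Ω⁻¹ * P) *ᵥ u) = u ⬝ᵥ (M *ᵥ w) := by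
    rw [hMw, dotProduct_mulVec, ← mulVec_transpose, transpose_mul, hOt, dotProduct_comm]
  simp only [sumElim_dotProduct_sumElim, Sum.elim_comp_inl, Sum.elim_comp_inr, neg_mulVec,
    dotProduct_add, dotProduct_neg, mulVec_sub, dotProduct_sub, sub_dotProduct, hs, hs2]
  rw [← hMw]
  change u ⬝ᵥ (M *ᵥ u) + _ + _ = _
  ring

lemma bl_cond {α β : Type*} [MeasureSpace α] [MeasureSpace β] [StandardBorelSpace α] [Nonempty α]
    [SigmaFinite (volume : Measure α)] [SigmaFinite (volume : Measure β)]
    (h : β → ℝ≥0∞) (g : β → α → ℝ≥0∞) (hh : Measurable h) (hg : Measurable (Function.uncurry g))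
    (hg1 : ∀ y, ∫⁻ x, g y x = 1) (ρ : Measure (α × β)) [IsFiniteMeasure ρ]
    (hρ : ρ = (volume : Measure (α × β)).withDensity fun p => h p.2 * g p.2 p.1) :
    ∀ᵐ y ∂(ρ.map Prod.snd), condDistrib Prod.fst Prod.snd ρ y = volume.withDensity (g y) := by
  let κ : Kernel β α := Kernel.withDensity (Kernel.const β (volume : Measure α)) g
  have hκ : ∀ y, κ y = volume.withDensity (g y) := fun y => by
    simp only [κ]; rw [Kernel.withDensity_apply _ hg, Kernel.const_apply]
  have : IsMarkovKernel κ := ⟨fun y => ⟨by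
    rw [hκ, withDensity_apply _ MeasurableSet.univ, Measure.restrict_univ, hg1]⟩⟩
  have hg' : Measurable fun p : α × β => g p.2 p.1 := hg.comp measurable_swap
  have hf : Measurable fun p : α × β => h p.2 * g p.2 p.1 := (hh.comp measurable_snd).mul hg'
  have hgy : ∀ y, Measurable (g y) := fun y => hg.comp measurable_prodMk_left
  have key : ∀ s : Set (β × α), MeasurableSet s → ρ (Prod.swap ⁻¹' s) =
      ∫⁻ y, h y * κ y (Prod.mk y ⁻¹' s) := by
    intro s hs
    have hs' : MeasurableSet (Prod.swap ⁻¹' s : Set (α × β)) := measurable_swap hs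
    rw [hρ, withDensity_apply _ hs', ← lintegral_indicator hs', Measure.volume_eq_prod,
      lintegral_prod_symm' _ (hf.indicator hs')]
    refine lintegral_congr fun y => ?_
    rw [hκ, withDensity_apply _ (measurable_prodMk_left hs),
      ← lintegral_indicator (measurable_prodMk_left hs),
      ← lintegral_const_mul _ ((hgy y).indicator (measurable_prodMk_left hs))]
    refine lintegral_congr fun x => ?_
    by_cases hx : (y, x) ∈ s <;> simp [Set.indicator, hx]
  have hsnd : ρ.map Prod.snd = volume.withDensity h := by
    ext t ht
    rw [Measure.map_apply measurable_snd ht, withDensity_apply _ ht]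
    have := key (Prod.fst ⁻¹' t) (measurable_fst ht)
    have e : (Prod.swap ⁻¹' (Prod.fst ⁻¹' t) : Set (α × β)) = Prod.snd ⁻¹' t := rfl
    rw [e] at this
    rw [this, ← lintegral_indicator ht]
    refine lintegral_congr fun y => ?_
    by_cases hy : y ∈ t <;> simp [Set.preimage, hy]
  have := condDistrib_ae_eq_of_measure_eq_compProd_of_measurable (μ := ρ) (κ := κ)
    measurable_snd measurable_fst (by
      have : SFinite (volume.withDensity h : Measure β) := hsnd ▸ inferInstance
      ext s hs
      rw [hsnd, Measure.compProd_apply hs, Measure.map_apply (by fun_prop) hs,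
        lintegral_withDensity_eq_lintegral_mul _ hh (Kernel.measurable_kernel_prodMk_left hs)]
      exact key s hs)
  filter_upwards [this] with y hy
  rw [hy, hκ]

/-- For `ρ`-almost every `y`, the conditional distribution of the returns `r`
(first coordinate) given the view `Y = y` (second coordinate) under the joint
Gaussian measure `ρ` is the Gaussian measure with the Black–Litterman posterior
mean `μ_BL(y) = (Σ⁻¹ + PᵀΩ⁻¹P)⁻¹(Σ⁻¹μ + PᵀΩ⁻¹y)` and covariance
`Σ_BL = (Σ⁻¹ + PᵀΩ⁻¹P)⁻¹`. -/
theorem blacklitterman_posterior (N K : ℕ) (hN : 0 < N) (hK : 0 < K)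
    (μ : Fin N → ℝ) (S : Matrix (Fin N) (Fin N) ℝ) (Ω : Matrix (Fin K) (Fin K) ℝ)
    (P : Matrix (Fin K) (Fin N) ℝ) (hS : S.PosDef) (hΩ : Ω.PosDef)
    [IsFiniteMeasure (blJointGaussian N K μ S Ω P)] :
    ∀ᵐ y ∂((blJointGaussian N K μ S Ω P).map Prod.snd),
      condDistrib Prod.fst Prod.snd (blJointGaussian N K μ S Ω P) y =
        gaussianPi
          ((S⁻¹ + Pᵀ * Ω⁻¹ * P)⁻¹ *ᵥ (S⁻¹ *ᵥ μ + (Pᵀ * Ω⁻¹) *ᵥ y))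
          (S⁻¹ + Pᵀ * Ω⁻¹ * P)⁻¹ := by
  have hM : (S⁻¹ + Pᵀ * Ω⁻¹ * P).PosDef := by
    refine hS.inv.add_posSemidef ?_
    have := hΩ.inv.posSemidef.conjTranspose_mul_mul_same P
    rwa [conjTranspose_eq_transpose_of_trivial] at this
  have hquad := bl_quad μ P hS hΩ hM
  dsimp only at hquad
  have hMd := (Matrix.isUnit_iff_isUnit_det _).1 hM.isUnit
  have hdet : 0 < ((S⁻¹ + Pᵀ * Ω⁻¹ * P)⁻¹).det := hM.inv.det_pos
  unfold gaussianPi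
  rw [Matrix.nonsing_inv_nonsing_inv _ hMd]
  set M := S⁻¹ + Pᵀ * Ω⁻¹ * P with hMdef
  set c := (Real.sqrt ((2 * Real.pi) ^ N * (M⁻¹).det))⁻¹ with hc
  have hc0 : 0 < c := by positivity
  set d := (Real.sqrt ((2 * Real.pi) ^ (N + K) *
          (Matrix.fromBlocks S (S * Pᵀ) (P * S) (P * S * Pᵀ + Ω)).det))⁻¹ with hd
  have hd0 : 0 ≤ d := by positivity
  let q : (Fin K → ℝ) → ℝ := fun y => 
    ((y - P *ᵥ μ) ⬝ᵥ (Ω⁻¹ *ᵥ (y - P *ᵥ μ)) - (M⁻¹ *ᵥ ((Pᵀ * Ω⁻¹) *ᵥ (y - P *ᵥ μ))) ⬝ᵥ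
      (M *ᵥ (M⁻¹ *ᵥ ((Pᵀ * Ω⁻¹) *ᵥ (y - P *ᵥ μ)))))
  have hq : Continuous q := by fun_prop
  refine bl_cond (fun y => ENNReal.ofReal (d / c * Real.exp (-(1/2) * q y))) 
    (fun y x => ENNReal.ofReal (c * Real.exp (-(1 / 2) *
      ((x - M⁻¹ *ᵥ (S⁻¹ *ᵥ μ + (Pᵀ * Ω⁻¹) *ᵥ y)) ⬝ᵥ
        (M *ᵥ (x - M⁻¹ *ᵥ (S⁻¹ *ᵥ μ + (Pᵀ * Ω⁻¹) *ᵥ y))))))) ?_ ?_ ?_ _ ?_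
  · have := hq.measurable
    fun_prop
  · unfold Function.uncurry
    apply Measurable.ennreal_ofReal
    apply Continuous.measurable
    fun_prop
  · intro y
    exact bl_norm _ hM
  · unfold blJointGaussian
    congr 1
    funext p
    rw [← hd, hquad p.1 p.2, ← ENNReal.ofReal_mul (by positivity)]
    congr 1
    rw [mul_add, Real.exp_add]
    simp only [q]
    field_simp
end

section
/- Let L be an invertible real N×N matrix with LLᵀ = Σ. Then the matrix H := (1/T)·(PL)ᵀ(PΣPᵀ + Ω)⁻¹(PL) admits the alternative representation H = (1/T)·(I_N − L⁻¹(Σ⁻¹ + PᵀΩ⁻¹P)⁻¹(Lᵀ)⁻¹). -/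
open Matrix
open scoped Matrix

/-- Alternative representation of
`H := (1/T)·(PL)ᵀ(PΣPᵀ + Ω)⁻¹(PL)` as
`H = (1/T)·(I_N − L⁻¹(Σ⁻¹ + PᵀΩ⁻¹P)⁻¹(Lᵀ)⁻¹)`. -/
theorem H_alternative_representation (N K : ℕ) (hN : 0 < N) (hK : 0 < K)
    (S : Matrix (Fin N) (Fin N) ℝ) (Ω : Matrix (Fin K) (Fin K) ℝ)
    (P : Matrix (Fin K) (Fin N) ℝ) (hS : S.PosDef) (hΩ : Ω.PosDef)
    (T : ℝ) (hT : 0 < T)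
    (L : Matrix (Fin N) (Fin N) ℝ) (hL : IsUnit L.det) (hLL : L * Lᵀ = S) :
    (1 / T) • ((P * L)ᵀ * (P * S * Pᵀ + Ω)⁻¹ * (P * L)) =
      (1 / T) • ((1 : Matrix (Fin N) (Fin N) ℝ) -
        L⁻¹ * (S⁻¹ + Pᵀ * Ω⁻¹ * P)⁻¹ * (Lᵀ)⁻¹) := by
  have hSu : IsUnit S := hS.isUnit
  have hSd : IsUnit S.det := (Matrix.isUnit_iff_isUnit_det _).1 hSu
  have hΩd : IsUnit Ω.det := (Matrix.isUnit_iff_isUnit_det _).1 hΩ.isUnit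
  have hLt : IsUnit (Lᵀ).det := by rwa [Matrix.det_transpose]
  have hM : (P * S * Pᵀ + Ω).PosDef := by
    have h := hS.posSemidef.mul_mul_conjTranspose_same P
    rw [Matrix.conjTranspose_eq_transpose_of_trivial] at h
    exact Matrix.PosDef.posSemidef_add h hΩ
  have hMu : IsUnit (Ω⁻¹⁻¹ + P * S⁻¹⁻¹ * Pᵀ) := by
    rw [Matrix.nonsing_inv_nonsing_inv _ hΩd, Matrix.nonsing_inv_nonsing_inv _ hSd, add_comm]
    exact hM.isUnit
  have hW := Matrix.add_mul_mul_inv_eq_sub S⁻¹ Pᵀ Ω⁻¹ P hS.inv.isUnit hΩ.inv.isUnit hMu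
  rw [Matrix.nonsing_inv_nonsing_inv _ hΩd, Matrix.nonsing_inv_nonsing_inv _ hSd,
    add_comm Ω] at hW
  rw [hW]
  have h1 : L⁻¹ * S = Lᵀ := by
    rw [← hLL, ← Matrix.mul_assoc, Matrix.nonsing_inv_mul _ hL, Matrix.one_mul]
  have h2 : S * (Lᵀ)⁻¹ = L := by
    rw [← hLL, Matrix.mul_assoc, Matrix.mul_nonsing_inv _ hLt, Matrix.mul_one]
  congr 1
  generalize (P * S * Pᵀ + Ω)⁻¹ = M
  have h3 : L⁻¹ * (S - S * Pᵀ * M * P * S) * (Lᵀ)⁻¹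
      = (L⁻¹ * S) * (Lᵀ)⁻¹ - (L⁻¹ * S) * Pᵀ * M * P * (S * (Lᵀ)⁻¹) := by
    simp only [Matrix.mul_sub, Matrix.sub_mul, Matrix.mul_assoc]
  rw [h3, h1, h2, Matrix.mul_nonsing_inv _ hLt, sub_sub_cancel, Matrix.transpose_mul]
  simp only [Matrix.mul_assoc]
end

section
/- Let L be an invertible real N×N matrix with LLᵀ = Σ, fix an index i, and let v := PL·e_i be the i-th column of PL. If v ≠ 0, then 0 < vᵀ(PΣPᵀ + Ω)⁻¹v < 1; consequently the Brownian-bridge hitting time T̃_i := T·(vᵀ(PΣPᵀ + Ω)⁻¹v)⁻¹ is finite and satisfies T̃_i > T. -/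
open Matrix
open scoped Matrix

/-- If the `i`-th column `v` of `PL` is nonzero, then
`0 < vᵀ(PΣPᵀ + Ω)⁻¹v < 1`, and the Brownian-bridge hitting time
`T̃_i := T·(vᵀ(PΣPᵀ + Ω)⁻¹v)⁻¹` satisfies `T̃_i > T`. -/
theorem hitting_time_exceeds_horizon (N K : ℕ) (hN : 0 < N) (hK : 0 < K)
    (S : Matrix (Fin N) (Fin N) ℝ) (Ω : Matrix (Fin K) (Fin K) ℝ)
    (P : Matrix (Fin K) (Fin N) ℝ) (hS : S.PosDef) (hΩ : Ω.PosDef)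
    (T : ℝ) (hT : 0 < T)
    (L : Matrix (Fin N) (Fin N) ℝ) (hL : IsUnit L.det) (hLL : L * Lᵀ = S)
    (i : Fin N) :
    let v : Fin K → ℝ := (P * L)ᵀ i
    v ≠ 0 →
      (0 < v ⬝ᵥ ((P * S * Pᵀ + Ω)⁻¹ *ᵥ v) ∧
        v ⬝ᵥ ((P * S * Pᵀ + Ω)⁻¹ *ᵥ v) < 1) ∧
      T < T * (v ⬝ᵥ ((P * S * Pᵀ + Ω)⁻¹ *ᵥ v))⁻¹ := by
  intro v hv
  set B := P * L with hB
  have hM : P * S * Pᵀ + Ω = B * Bᵀ + Ω := by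
    rw [← hLL, hB, Matrix.transpose_mul]
    simp only [Matrix.mul_assoc]
  rw [hM]
  have hBB : (B * Bᵀ).PosSemidef := by
    have h := Matrix.posSemidef_self_mul_conjTranspose B
    rwa [Matrix.conjTranspose_eq_transpose_of_trivial] at h
  have hpd : (B * Bᵀ + Ω).PosDef := Matrix.PosDef.posSemidef_add hBB hΩ
  have hdet : IsUnit (B * Bᵀ + Ω).det := (Matrix.isUnit_iff_isUnit_det _).1 hpd.isUnit
  set w := (B * Bᵀ + Ω)⁻¹ *ᵥ v with hw
  have hMw : (B * Bᵀ + Ω) *ᵥ w = v := by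
    rw [hw, Matrix.mulVec_mulVec, Matrix.mul_nonsing_inv _ hdet, Matrix.one_mulVec]
  have hw0 : w ≠ 0 := by
    intro h
    rw [h, Matrix.mulVec_zero] at hMw
    exact hv hMw.symm
  have hO : 0 < w ⬝ᵥ (Ω *ᵥ w) := by
    have h := hΩ.dotProduct_mulVec_pos hw0
    simpa using h
  have hq : v ⬝ᵥ w = (Bᵀ *ᵥ w) ⬝ᵥ (Bᵀ *ᵥ w) + w ⬝ᵥ (Ω *ᵥ w) := by
    have h1 : (Bᵀ *ᵥ w) ⬝ᵥ (Bᵀ *ᵥ w) = w ⬝ᵥ ((B * Bᵀ) *ᵥ w) := by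
      rw [← Matrix.mulVec_mulVec, Matrix.dotProduct_mulVec w B, Matrix.mulVec_transpose]
    rw [h1, ← dotProduct_add, ← Matrix.add_mulVec, hMw, dotProduct_comm]
  have hsq : (v ⬝ᵥ w) * (v ⬝ᵥ w) ≤ (Bᵀ *ᵥ w) ⬝ᵥ (Bᵀ *ᵥ w) :=
    Finset.single_le_sum (f := fun j => (Bᵀ *ᵥ w) j * (Bᵀ *ᵥ w) j)
      (fun j _ => mul_self_nonneg _) (Finset.mem_univ i)
  generalize v ⬝ᵥ w = q at *
  have h0 : 0 < q := by nlinarith [mul_self_nonneg q]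
  have h1 : q < 1 := by nlinarith
  exact ⟨⟨h0, h1⟩, lt_mul_of_one_lt_right hT ((one_lt_inv₀ h0).2 h1)⟩
end

section
/- Define η : ℝ → Matrix (Fin N) (Fin N) ℝ by η(t) := −Pᵀ((T−t)·PΣPᵀ + T·Ω)⁻¹P. Then for every t ∈ [0, T], η(t) is symmetric and negative semidefinite, and the map η has derivative −η(t)·Σ·η(t) at t (in the sense of HasDerivAt); in particular η satisfies the matrix differential equation η′(t) = −η(t) Σ η(t) with η(T) = −Pᵀ(TΩ)⁻¹P. -/
open Matrix
open scoped Matrix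

attribute [local instance] Matrix.normedAddCommGroup Matrix.normedSpace

/-- `η(t) := −Pᵀ((T−t)·PΣPᵀ + T·Ω)⁻¹P` is symmetric and negative semidefinite on
`[0, T]`, satisfies the matrix ODE `η′(t) = −η(t) Σ η(t)` there, and has terminal
value `η(T) = −Pᵀ(TΩ)⁻¹P`. -/
theorem eta_matrix_ode (N K : ℕ) (hN : 0 < N) (hK : 0 < K)
    (S : Matrix (Fin N) (Fin N) ℝ) (Ω : Matrix (Fin K) (Fin K) ℝ)
    (P : Matrix (Fin K) (Fin N) ℝ) (hS : S.PosDef) (hΩ : Ω.PosDef)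
    (T : ℝ) (hT : 0 < T) :
    let η : ℝ → Matrix (Fin N) (Fin N) ℝ :=
      fun t => -(Pᵀ * ((T - t) • (P * S * Pᵀ) + T • Ω)⁻¹ * P)
    (∀ t ∈ Set.Icc (0 : ℝ) T,
        (η t).IsSymm ∧ (-(η t)).PosSemidef ∧
        HasDerivAt η (-(η t * S * η t)) t) ∧
      η T = -(Pᵀ * (T • Ω)⁻¹ * P) := by
  intro η
  have hA : (P * S * Pᵀ).PosSemidef := by
    have := hS.posSemidef.mul_mul_conjTranspose_same P
    rwa [conjTranspose_eq_transpose_of_trivial] at this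
  have hM : ∀ t ∈ Set.Icc (0 : ℝ) T, ((T - t) • (P * S * Pᵀ) + T • Ω).PosDef := by
    intro t ht
    exact Matrix.PosDef.posSemidef_add (hA.smul (sub_nonneg.2 ht.2)) (hΩ.smul hT)
  refine ⟨fun t ht => ?_, by simp [η]⟩
  have hneg : (-(η t)).PosSemidef := by
    have := (hM t ht).inv.posSemidef.conjTranspose_mul_mul_same P
    rw [conjTranspose_eq_transpose_of_trivial] at this
    simpa [η] using this
  refine ⟨?_, hneg, ?_⟩
  · have h := hneg.isHermitian
    rw [Matrix.IsHermitian, conjTranspose_eq_transpose_of_trivial, transpose_neg] at h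
    exact neg_injective h
  · set M : ℝ → Matrix (Fin K) (Fin K) ℝ := fun t => (T - t) • (P * S * Pᵀ) + T • Ω with hMdef
    have hη : ∀ s, η s = -(Pᵀ * (M s)⁻¹ * P) := fun s => rfl
    have hMc : Continuous M := by fun_prop
    have hdet : (M t).det ≠ 0 := (hM t ht).det_pos.ne'
    have hdc : Continuous fun s => (M s).det := hMc.matrix_det
    have hinv : ContinuousAt (fun s => (M s)⁻¹) t := by
      simp only [Matrix.inv_def, Ring.inverse_eq_inv']
      exact (hdc.continuousAt.inv₀ hdet).smul hMc.matrix_adjugate.continuousAt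
    have hev : ∀ᶠ s in nhds t, (M s).det ≠ 0 := hdc.continuousAt.eventually_ne hdet
    refine (hasDerivAt_iff_tendsto_slope (F := Matrix (Fin N) (Fin N) ℝ)).2 ?_
    have key : Filter.Tendsto (fun s => -(Pᵀ * ((M s)⁻¹ * (P * S * Pᵀ) * (M t)⁻¹) * P))
        (nhdsWithin t {t}ᶜ) (nhds (-(η t * S * η t))) := by
      have e : -(η t * S * η t) = -(Pᵀ * ((M t)⁻¹ * (P * S * Pᵀ) * (M t)⁻¹) * P) := by
        simp only [hη, Matrix.neg_mul, Matrix.mul_neg, neg_neg, Matrix.mul_assoc]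
      rw [e]
      have hc : Continuous fun X : Matrix (Fin K) (Fin K) ℝ =>
        -(Pᵀ * (X * (P * S * Pᵀ) * (M t)⁻¹) * P) := by fun_prop
      exact (hc.continuousAt.tendsto.comp hinv.tendsto).mono_left nhdsWithin_le_nhds
    refine key.congr' ?_
    filter_upwards [nhdsWithin_le_nhds hev, self_mem_nhdsWithin] with s hs hst
    have hst' : s - t ≠ 0 := sub_ne_zero.2 hst
    have hd : (M s)⁻¹ - (M t)⁻¹ = (s - t) • ((M s)⁻¹ * (P * S * Pᵀ) * (M t)⁻¹) := by
      have h1 : M t - M s = (s - t) • (P * S * Pᵀ) := by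
        simp only [hMdef]; module
      have h2 : (M s)⁻¹ * (M t - M s) * (M t)⁻¹ = (M s)⁻¹ - (M t)⁻¹ := by
        rw [Matrix.mul_sub, Matrix.sub_mul, Matrix.nonsing_inv_mul _ (isUnit_iff_ne_zero.2 hs),
          Matrix.mul_assoc, Matrix.mul_nonsing_inv _ (isUnit_iff_ne_zero.2 hdet)]
        simp
      rw [← h2, h1]; simp only [Matrix.mul_smul, Matrix.smul_mul]
    have h3 : η s - η t = -(Pᵀ * ((M s)⁻¹ - (M t)⁻¹) * P) := by
      simp only [hη, Matrix.mul_sub, Matrix.sub_mul]; abel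
    rw [slope_def_module, h3, hd]
    simp only [Matrix.mul_smul, Matrix.smul_mul, smul_neg, smul_smul, inv_mul_cancel₀ hst', one_smul]
end

section
/- Let γ > 0 and define ζ : ℝ → Matrix (Fin N) (Fin N) ℝ by ζ(t) := −Pᵀ(((T−t)/γ)·PΣPᵀ + T·Ω)⁻¹P. Then for every t ∈ [0, T] the map ζ has derivative −(1/γ)·ζ(t)·Σ·ζ(t) at t (in the sense of HasDerivAt), i.e. ζ′(t) + (1/γ)·ζ(t) Σ ζ(t) = 0, and ζ(T) = −Pᵀ(TΩ)⁻¹P, which equals the terminal value η(T) of η(t) := −Pᵀ((T−t)·PΣPᵀ + T·Ω)⁻¹P. -/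
open Matrix
open scoped Matrix

attribute [local instance] Matrix.normedAddCommGroup Matrix.normedSpace

/-- `ζ(t) := −Pᵀ(((T−t)/γ)·PΣPᵀ + T·Ω)⁻¹P` satisfies the matrix ODE
`ζ′(t) + (1/γ)·ζ(t) Σ ζ(t) = 0` on `[0, T]`, with terminal value
`ζ(T) = −Pᵀ(TΩ)⁻¹P = η(T)`. -/
theorem zeta_matrix_ode (N K : ℕ) (hN : 0 < N) (hK : 0 < K)
    (S : Matrix (Fin N) (Fin N) ℝ) (Ω : Matrix (Fin K) (Fin K) ℝ)
    (P : Matrix (Fin K) (Fin N) ℝ) (hS : S.PosDef) (hΩ : Ω.PosDef)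
    (T : ℝ) (hT : 0 < T) (γ : ℝ) (hγ : 0 < γ) :
    let ζ : ℝ → Matrix (Fin N) (Fin N) ℝ :=
      fun t => -(Pᵀ * (((T - t) / γ) • (P * S * Pᵀ) + T • Ω)⁻¹ * P)
    let η : ℝ → Matrix (Fin N) (Fin N) ℝ :=
      fun t => -(Pᵀ * ((T - t) • (P * S * Pᵀ) + T • Ω)⁻¹ * P)
    (∀ t ∈ Set.Icc (0 : ℝ) T,
        HasDerivAt ζ (-((1 / γ) • (ζ t * S * ζ t))) t) ∧
      ζ T = -(Pᵀ * (T • Ω)⁻¹ * P) ∧ ζ T = η T := by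
  intro ζ η
  refine ⟨?_, by simp [ζ], by simp [ζ, η]⟩
  intro t ht
  let A : ℝ → Matrix (Fin K) (Fin K) ℝ := fun s => ((T - s) / γ) • (P * S * Pᵀ) + T • Ω
  have hA : Continuous A := by
    refine continuous_matrix fun i j => ?_
    simp only [A, Matrix.add_apply, Matrix.smul_apply, smul_eq_mul]
    fun_prop
  have hpos : (A t).PosDef := by
    have h1 : (P * S * Pᵀ).PosSemidef := by
      simpa using hS.posSemidef.mul_mul_conjTranspose_same P
    have h2 : 0 ≤ (T - t) / γ := div_nonneg (by linarith [ht.2]) hγ.le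
    exact Matrix.PosDef.posSemidef_add (h1.smul h2) (hΩ.smul hT)
  have hdet : (A t).det ≠ 0 := hpos.det_pos.ne'
  have hdc : Continuous fun s => (A s).det := hA.matrix_det
  have hev : ∀ᶠ s in nhds t, (A s).det ≠ 0 := hdc.continuousAt.eventually_ne hdet
  have hinv : ContinuousAt (fun s => (A s)⁻¹) t := by
    have e : (fun s => (A s)⁻¹) = fun s => ((A s).det)⁻¹ • (A s).adjugate := by
      funext s
      rw [Matrix.inv_def, Ring.inverse_eq_inv']
    rw [e]
    exact (hdc.continuousAt.inv₀ hdet).smul hA.matrix_adjugate.continuousAt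
  have hζ : ContinuousAt ζ t := by
    have hc : Continuous fun B : Matrix (Fin K) (Fin K) ℝ => -(Pᵀ * B * P) :=
      ((continuous_const.matrix_mul continuous_id).matrix_mul continuous_const).neg
    exact hc.continuousAt.comp hinv
  have hF : ContinuousAt (fun s => -((1 / γ) • (ζ s * S * ζ t))) t := by
    have hc : Continuous fun B : Matrix (Fin N) (Fin N) ℝ => -((1 / γ) • (B * S * ζ t)) :=
      (((continuous_id.matrix_mul continuous_const).matrix_mul continuous_const).const_smul
        (1 / γ)).neg
    exact hc.continuousAt.comp hζ
  refine (hasDerivAt_iff_tendsto_slope (F := Matrix (Fin N) (Fin N) ℝ)).mpr ?_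
  refine Filter.Tendsto.congr' ?_ (hF.tendsto.mono_left nhdsWithin_le_nhds)
  filter_upwards [hev.filter_mono nhdsWithin_le_nhds, self_mem_nhdsWithin] with s hs hst
  have hst' : s - t ≠ 0 := sub_ne_zero.mpr hst
  have hus : IsUnit (A s).det := hs.isUnit
  have hut : IsUnit (A t).det := hdet.isUnit
  have hdiff : A t - A s = ((s - t) / γ) • (P * S * Pᵀ) := by
    simp only [A]
    rw [add_sub_add_right_eq_sub, ← sub_smul]
    congr 1
    ring
  have hres : (A s)⁻¹ - (A t)⁻¹ = ((s - t) / γ) • ((A s)⁻¹ * (P * S * Pᵀ) * (A t)⁻¹) := by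
    have : (A s)⁻¹ - (A t)⁻¹ = (A s)⁻¹ * (A t - A s) * (A t)⁻¹ := by
      rw [Matrix.mul_sub, Matrix.sub_mul, Matrix.nonsing_inv_mul _ hus, Matrix.mul_assoc,
        Matrix.mul_nonsing_inv _ hut, Matrix.mul_one, Matrix.one_mul]
    rw [this, hdiff, Matrix.mul_smul, Matrix.smul_mul]
  have hd : ζ s - ζ t = -(Pᵀ * ((A s)⁻¹ - (A t)⁻¹) * P) := by
    simp only [ζ, A, Matrix.mul_sub, Matrix.sub_mul]
    abel
  have hz : ∀ r, ζ r = -(Pᵀ * (A r)⁻¹ * P) := fun r => rfl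
  rw [slope_def_module, hd, hres, hz s, hz t, Matrix.mul_smul, Matrix.smul_mul, smul_neg,
    smul_smul]
  have hc : (s - t)⁻¹ * ((s - t) / γ) = 1 / γ := by field_simp
  rw [hc]
  simp only [Matrix.neg_mul, Matrix.mul_neg, neg_neg, Matrix.mul_assoc]
end

section
/- Define β₂(t) := ΣPᵀ((T−t)·PΣPᵀ + T·Ω)⁻¹P. Then for all real numbers s, u with 0 ≤ s ≤ u ≤ T, the flow identity β₂(u)·(I_N − (u−s)·β₂(s)) = β₂(s) holds. -/
open Matrix
open scoped Matrix

/-- The flow identity `β₂(u)·(I_N − (u−s)·β₂(s)) = β₂(s)` for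
`β₂(t) := ΣPᵀ((T−t)·PΣPᵀ + T·Ω)⁻¹P` and `0 ≤ s ≤ u ≤ T`. -/
theorem beta2_flow_identity (N K : ℕ) (hN : 0 < N) (hK : 0 < K)
    (S : Matrix (Fin N) (Fin N) ℝ) (Ω : Matrix (Fin K) (Fin K) ℝ)
    (P : Matrix (Fin K) (Fin N) ℝ) (hS : S.PosDef) (hΩ : Ω.PosDef)
    (T : ℝ) (hT : 0 < T) :
    let β₂ : ℝ → Matrix (Fin N) (Fin N) ℝ :=
      fun t => S * Pᵀ * ((T - t) • (P * S * Pᵀ) + T • Ω)⁻¹ * P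
    ∀ s u : ℝ, 0 ≤ s → s ≤ u → u ≤ T →
      β₂ u * ((1 : Matrix (Fin N) (Fin N) ℝ) - (u - s) • β₂ s) = β₂ s := by
  intro β₂ s u hs hsu hu
  have hA : (P * S * Pᵀ).PosSemidef := by
    have h := hS.posSemidef.mul_mul_conjTranspose_same P
    rwa [conjTranspose_eq_transpose_of_trivial] at h
  have hM : ∀ t : ℝ, t ≤ T → IsUnit ((T - t) • (P * S * Pᵀ) + T • Ω).det := by
    intro t ht
    have h : ((T - t) • (P * S * Pᵀ) + T • Ω).PosDef :=
      PosDef.posSemidef_add (hA.smul (sub_nonneg.2 ht)) (hΩ.smul hT)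
    exact h.det_pos.ne'.isUnit
  have h1 := hM s (hsu.trans hu)
  have h2 := hM u hu
  simp only [β₂]
  have hA2 : (T - u) • (P * S * Pᵀ) + T • Ω
      = ((T - s) • (P * S * Pᵀ) + T • Ω) - (u - s) • (P * S * Pᵀ) := by
    module
  generalize (T - s) • (P * S * Pᵀ) + T • Ω = Ms at *
  generalize (T - u) • (P * S * Pᵀ) + T • Ω = Mu at *
  have key : Mu⁻¹ - (u - s) • (Mu⁻¹ * (P * S * Pᵀ) * Ms⁻¹) = Ms⁻¹ := by
    calc Mu⁻¹ - (u - s) • (Mu⁻¹ * (P * S * Pᵀ) * Ms⁻¹)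
        = Mu⁻¹ * (Ms - (u - s) • (P * S * Pᵀ)) * Ms⁻¹ := by
          rw [Matrix.mul_sub, Matrix.sub_mul, Matrix.mul_assoc Mu⁻¹ Ms,
            Matrix.mul_nonsing_inv _ h1, Matrix.mul_one, Matrix.mul_smul, Matrix.smul_mul]
      _ = Ms⁻¹ := by
          rw [← hA2, Matrix.nonsing_inv_mul _ h2, Matrix.one_mul]
  calc _ = S * Pᵀ * (Mu⁻¹ - (u - s) • (Mu⁻¹ * (P * S * Pᵀ) * Ms⁻¹)) * P := by
        simp only [Matrix.mul_sub, Matrix.sub_mul, Matrix.mul_smul, Matrix.smul_mul,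
          Matrix.mul_one, Matrix.mul_assoc]
    _ = _ := by rw [key]
end

section
/- Define β₁ := (1/T)·ΣPᵀ(PΣPᵀ + Ω)⁻¹ and β₂(t) := ΣPᵀ((T−t)·PΣPᵀ + T·Ω)⁻¹P. Then for every t ∈ [0, T], ΣPᵀ((T−t)·PΣPᵀ + T·Ω)⁻¹ = (I_N + t·β₂(t))·β₁. -/
open Matrix
open scoped Matrix

/-- With `β₁ := (1/T)·ΣPᵀ(PΣPᵀ + Ω)⁻¹` and
`β₂(t) := ΣPᵀ((T−t)·PΣPᵀ + T·Ω)⁻¹P`, for every `t ∈ [0, T]` we have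
`ΣPᵀ((T−t)·PΣPᵀ + T·Ω)⁻¹ = (I_N + t·β₂(t))·β₁`. -/
theorem beta1_beta2_identity (N K : ℕ) (hN : 0 < N) (hK : 0 < K)
    (S : Matrix (Fin N) (Fin N) ℝ) (Ω : Matrix (Fin K) (Fin K) ℝ)
    (P : Matrix (Fin K) (Fin N) ℝ) (hS : S.PosDef) (hΩ : Ω.PosDef)
    (T : ℝ) (hT : 0 < T) :
    let β₁ : Matrix (Fin N) (Fin K) ℝ := (1 / T) • (S * Pᵀ * (P * S * Pᵀ + Ω)⁻¹)
    let β₂ : ℝ → Matrix (Fin N) (Fin N) ℝ :=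
      fun t => S * Pᵀ * ((T - t) • (P * S * Pᵀ) + T • Ω)⁻¹ * P
    ∀ t ∈ Set.Icc (0 : ℝ) T,
      S * Pᵀ * ((T - t) • (P * S * Pᵀ) + T • Ω)⁻¹ =
        ((1 : Matrix (Fin N) (Fin N) ℝ) + t • β₂ t) * β₁ := by
  intro β₁ β₂ t ht
  have hA : (P * S * Pᵀ).PosSemidef := by
    have h := hS.posSemidef.mul_mul_conjTranspose_same P
    rwa [conjTranspose_eq_transpose_of_trivial] at h
  have hB : (P * S * Pᵀ + Ω).PosDef := Matrix.PosDef.posSemidef_add hA hΩ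
  have hM : ((T - t) • (P * S * Pᵀ) + T • Ω).PosDef :=
    Matrix.PosDef.posSemidef_add (hA.smul (sub_nonneg.2 ht.2)) (hΩ.smul hT)
  have hBu := (Matrix.isUnit_iff_isUnit_det _).1 hB.isUnit
  have hMu := (Matrix.isUnit_iff_isUnit_det _).1 hM.isUnit
  simp only [β₁, β₂]
  have hMB : ((T - t) • (P * S * Pᵀ) + T • Ω) + t • (P * S * Pᵀ) = T • (P * S * Pᵀ + Ω) := by
    module
  have e : S * Pᵀ * ((T - t) • (P * S * Pᵀ) + T • Ω)⁻¹ * P * (S * Pᵀ * (P * S * Pᵀ + Ω)⁻¹)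
      = S * Pᵀ * (((T - t) • (P * S * Pᵀ) + T • Ω)⁻¹ * (P * S * Pᵀ) * (P * S * Pᵀ + Ω)⁻¹) := by
    simp only [Matrix.mul_assoc]
  rw [Matrix.mul_smul, Matrix.add_mul, Matrix.one_mul, Matrix.smul_mul, e]
  generalize P * S * Pᵀ = A at *
  generalize A + Ω = B at *
  generalize (T - t) • A + T • Ω = M at *
  have h1 : (1 : Matrix (Fin K) (Fin K) ℝ) + t • (M⁻¹ * A) = T • (M⁻¹ * B) := by
    rw [← Matrix.mul_smul, ← Matrix.mul_smul, ← hMB, Matrix.mul_add, Matrix.nonsing_inv_mul _ hMu]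
  have h2 : B⁻¹ + t • (M⁻¹ * A * B⁻¹) = T • M⁻¹ := by
    have h3 := congrArg (fun X => X * B⁻¹) h1
    simpa [Matrix.add_mul, Matrix.smul_mul, Matrix.mul_assoc, Matrix.mul_nonsing_inv _ hBu] using h3
  rw [← Matrix.mul_smul, ← Matrix.mul_add, h2, Matrix.mul_smul, smul_smul,
    one_div_mul_cancel hT.ne', one_smul]
end

section
/- Let γ > 1 and define η(t) := −Pᵀ((T−t)·PΣPᵀ + T·Ω)⁻¹P, ζ(t) := −Pᵀ(((T−t)/γ)·PΣPᵀ + T·Ω)⁻¹P, and A(t) := ζ(t) − η(t). Then A(T) = 0 and for every t ∈ [0, T] the map A has derivative −[((1−γ)/γ)·η(t) Σ η(t) + (1/γ)·(A(t) Σ η(t) + η(t) Σ A(t)) + (1/γ)·A(t) Σ A(t)] at t (in the sense of HasDerivAt); that is, A solves the matrix Riccati equation A′(t) + ((1−γ)/γ)·η(t) Σ η(t) + (1/γ)·(A(t) Σ η(t) + η(t) Σ A(t)) + (1/γ)·A(t) Σ A(t) = 0 with terminal condition A(T) = 0. -/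
open Matrix
open scoped Matrix

attribute [local instance] Matrix.normedAddCommGroup Matrix.normedSpace

lemma riccati_aux {N K : ℕ} (S : Matrix (Fin N) (Fin N) ℝ) (Q : Matrix (Fin K) (Fin K) ℝ)
    (P : Matrix (Fin K) (Fin N) ℝ) (hS : S.PosDef) (hQ : Q.PosDef) (T c : ℝ) (hc : 0 < c)
    (t : ℝ) (ht : t ≤ T) :
    HasDerivAt (fun s : ℝ => -(Pᵀ * (((T - s) * c) • (P * S * Pᵀ) + Q)⁻¹ * P))
      (-(c • ((-(Pᵀ * (((T - t) * c) • (P * S * Pᵀ) + Q)⁻¹ * P)) * S *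
        (-(Pᵀ * (((T - t) * c) • (P * S * Pᵀ) + Q)⁻¹ * P))))) t := by
  set B := P * S * Pᵀ with hB
  set M : ℝ → Matrix (Fin K) (Fin K) ℝ := fun s => ((T - s) * c) • B + Q with hM
  have hBp : B.PosSemidef := by
    have := hS.posSemidef.mul_mul_conjTranspose_same P
    rwa [conjTranspose_eq_transpose_of_trivial] at this
  have hMt : (M t).PosDef :=
    Matrix.PosDef.posSemidef_add (hBp.smul (mul_nonneg (sub_nonneg.2 ht) hc.le)) hQ
  have hdt : (M t).det ≠ 0 := hMt.det_pos.ne'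
  have hMc : Continuous M := by
    rw [hM]
    exact ((by fun_prop : Continuous fun s : ℝ => (T - s) * c).smul continuous_const).add
      continuous_const
  have hdc : Continuous fun s => (M s).det := hMc.matrix_det
  have hic : ContinuousAt (fun s => (M s)⁻¹) t := by
    have : (fun s => (M s)⁻¹) = fun s => ((M s).det)⁻¹ • (M s).adjugate := by
      funext s
      rw [Matrix.inv_def, Ring.inverse_eq_inv']
    rw [this]
    exact (hdc.continuousAt.inv₀ hdt).smul hMc.matrix_adjugate.continuousAt
  have hev : ∀ᶠ s in nhds t, (M s).det ≠ 0 := hdc.continuousAt.eventually_ne hdt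
  refine (hasDerivAt_iff_tendsto_slope (F := Matrix (Fin N) (Fin N) ℝ)).2 ?_
  have hG : ContinuousAt (fun s => -(c • (Pᵀ * ((M s)⁻¹ * B * (M t)⁻¹) * P))) t := by
    have h1 : Continuous fun X : Matrix (Fin K) (Fin K) ℝ =>
        -(c • (Pᵀ * (X * B * (M t)⁻¹) * P)) := by fun_prop
    exact h1.continuousAt.comp (f := fun s => (M s)⁻¹) hic
  have hG' := hG.tendsto.mono_left (nhdsWithin_le_nhds (s := {t}ᶜ))
  have hval : -(c • ((-(Pᵀ * (M t)⁻¹ * P)) * S * (-(Pᵀ * (M t)⁻¹ * P)))) =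
      -(c • (Pᵀ * ((M t)⁻¹ * B * (M t)⁻¹) * P)) := by
    simp only [hB, Matrix.mul_assoc, Matrix.neg_mul, Matrix.mul_neg, neg_neg]
  change Filter.Tendsto _ _ (nhds (-(c • ((-(Pᵀ * (M t)⁻¹ * P)) * S * (-(Pᵀ * (M t)⁻¹ * P))))))
  rw [hval]
  refine hG'.congr' ?_
  filter_upwards [hev.filter_mono nhdsWithin_le_nhds, self_mem_nhdsWithin] with s hs hst
  have hne : s - t ≠ 0 := sub_ne_zero.2 hst
  have key : (M s)⁻¹ - (M t)⁻¹ = ((s - t) * c) • ((M s)⁻¹ * B * (M t)⁻¹) := by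
    have e1 : M t - M s = ((s - t) * c) • B := by
      simp only [hM, add_sub_add_right_eq_sub, ← sub_smul]
      congr 1; ring
    have e2 : (M s)⁻¹ * (M t - M s) * (M t)⁻¹ = (M s)⁻¹ - (M t)⁻¹ := by
      rw [Matrix.mul_sub, Matrix.sub_mul, Matrix.nonsing_inv_mul _ (isUnit_iff_ne_zero.2 hs),
        Matrix.mul_assoc, Matrix.mul_nonsing_inv _ (isUnit_iff_ne_zero.2 hdt), Matrix.mul_one,
        Matrix.one_mul]
    rw [← e2, e1, Matrix.mul_smul, Matrix.smul_mul]
  rw [slope_def_module]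
  have e3 : -(Pᵀ * (M s)⁻¹ * P) - -(Pᵀ * (M t)⁻¹ * P) =
      -(Pᵀ * ((M s)⁻¹ - (M t)⁻¹) * P) := by
    rw [Matrix.mul_sub, Matrix.sub_mul]; abel
  change _ = (s - t)⁻¹ • (-(Pᵀ * (M s)⁻¹ * P) - -(Pᵀ * (M t)⁻¹ * P))
  rw [e3, key, Matrix.mul_smul, Matrix.smul_mul, smul_neg, smul_smul, ← mul_assoc,
    inv_mul_cancel₀ hne, one_mul]

/-- With `η(t) := −Pᵀ((T−t)·PΣPᵀ + T·Ω)⁻¹P`,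
`ζ(t) := −Pᵀ(((T−t)/γ)·PΣPᵀ + T·Ω)⁻¹P` and `A(t) := ζ(t) − η(t)`, the function
`A` solves the matrix Riccati equation
`A′(t) + ((1−γ)/γ)·η Σ η + (1/γ)·(A Σ η + η Σ A) + (1/γ)·A Σ A = 0` on `[0, T]`
with terminal condition `A(T) = 0`. -/
theorem riccati_solution (N K : ℕ) (hN : 0 < N) (hK : 0 < K)
    (S : Matrix (Fin N) (Fin N) ℝ) (Ω : Matrix (Fin K) (Fin K) ℝ)
    (P : Matrix (Fin K) (Fin N) ℝ) (hS : S.PosDef) (hΩ : Ω.PosDef)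
    (T : ℝ) (hT : 0 < T) (γ : ℝ) (hγ : 1 < γ) :
    let η : ℝ → Matrix (Fin N) (Fin N) ℝ :=
      fun t => -(Pᵀ * ((T - t) • (P * S * Pᵀ) + T • Ω)⁻¹ * P)
    let ζ : ℝ → Matrix (Fin N) (Fin N) ℝ :=
      fun t => -(Pᵀ * (((T - t) / γ) • (P * S * Pᵀ) + T • Ω)⁻¹ * P)
    let A : ℝ → Matrix (Fin N) (Fin N) ℝ := fun t => ζ t - η t
    A T = 0 ∧
      ∀ t ∈ Set.Icc (0 : ℝ) T,
        HasDerivAt A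
          (-(((1 - γ) / γ) • (η t * S * η t) +
              (1 / γ) • (A t * S * η t + η t * S * A t) +
              (1 / γ) • (A t * S * A t))) t := by
  intro η ζ A
  have hγ0 : γ ≠ 0 := by linarith
  refine ⟨by simp [A, η, ζ], fun t ht => ?_⟩
  have hQ : (T • Ω).PosDef := hΩ.smul hT
  have h1 := riccati_aux S (T • Ω) P hS hQ T 1 one_pos t ht.2
  have h2 := riccati_aux S (T • Ω) P hS hQ T γ⁻¹ (inv_pos.2 (by linarith)) t ht.2
  simp only [mul_one, one_smul] at h1
  simp only [← div_eq_mul_inv] at h2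
  have h3 : HasDerivAt A (-(γ⁻¹ • (ζ t * S * ζ t)) - -(η t * S * η t)) t := h2.sub h1
  convert h3 using 1
  have hz : ζ t = A t + η t := by simp [A]
  rw [hz]
  have hc : (1 - γ) / γ = γ⁻¹ - 1 := by field_simp
  rw [hc, one_div]
  simp only [Matrix.add_mul, Matrix.mul_add, smul_add, sub_smul, one_smul]
  abel
end

section
/- Let γ > 1 and define η(t) := −Pᵀ((T−t)·PΣPᵀ + T·Ω)⁻¹P, ζ(t) := −Pᵀ(((T−t)/γ)·PΣPᵀ + T·Ω)⁻¹P and M(t) := (γ−1)(1 − t/T)·PᵀΩ⁻¹P·(γΣ⁻¹ + (1 − t/T)·PᵀΩ⁻¹P)⁻¹. Then for every t ∈ [0, T), (i) ζ(t) − η(t) = M(t)·η(t); (ii) the matrix (γ/((γ−1)(T−t)))·Σ⁻¹ + η(t) is positive definite (hence invertible) and M(t) = −η(t)·((γ/((γ−1)(T−t)))·Σ⁻¹ + η(t))⁻¹, so that ζ(t) − η(t) = −η(t)·((γ/((γ−1)(T−t)))·Σ⁻¹ + η(t))⁻¹·η(t). -/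
open Matrix
open scoped Matrix

/-- For `t ∈ [0, T)`:
(i) `ζ(t) − η(t) = M(t)·η(t)`;
(ii) `(γ/((γ−1)(T−t)))·Σ⁻¹ + η(t)` is positive definite and
`M(t) = −η(t)·((γ/((γ−1)(T−t)))·Σ⁻¹ + η(t))⁻¹`, hence
`ζ(t) − η(t) = −η(t)·((γ/((γ−1)(T−t)))·Σ⁻¹ + η(t))⁻¹·η(t)`. -/
theorem M_eta_zeta_identities (N K : ℕ) (hN : 0 < N) (hK : 0 < K)
    (S : Matrix (Fin N) (Fin N) ℝ) (Ω : Matrix (Fin K) (Fin K) ℝ)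
    (P : Matrix (Fin K) (Fin N) ℝ) (hS : S.PosDef) (hΩ : Ω.PosDef)
    (T : ℝ) (hT : 0 < T) (γ : ℝ) (hγ : 1 < γ) :
    let η : ℝ → Matrix (Fin N) (Fin N) ℝ :=
      fun t => -(Pᵀ * ((T - t) • (P * S * Pᵀ) + T • Ω)⁻¹ * P)
    let ζ : ℝ → Matrix (Fin N) (Fin N) ℝ :=
      fun t => -(Pᵀ * (((T - t) / γ) • (P * S * Pᵀ) + T • Ω)⁻¹ * P)
    let M : ℝ → Matrix (Fin N) (Fin N) ℝ := fun t =>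
      ((γ - 1) * (1 - t / T)) •
        (Pᵀ * Ω⁻¹ * P * (γ • S⁻¹ + (1 - t / T) • (Pᵀ * Ω⁻¹ * P))⁻¹)
    ∀ t ∈ Set.Ico (0 : ℝ) T,
      ζ t - η t = M t * η t ∧
      ((γ / ((γ - 1) * (T - t))) • S⁻¹ + η t).PosDef ∧
      M t = -(η t * ((γ / ((γ - 1) * (T - t))) • S⁻¹ + η t)⁻¹) ∧
      ζ t - η t =
        -(η t * ((γ / ((γ - 1) * (T - t))) • S⁻¹ + η t)⁻¹ * η t) := by
  intro η ζ M t ht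
  obtain ⟨ht0, htT⟩ := ht
  have hτ : 0 < T - t := by linarith
  have hs : 1 - t / T = (T - t) / T := by field_simp
  simp only [η, ζ, M, hs]
  clear_value η ζ M
  clear η ζ M hs
  generalize T - t = τ at hτ ⊢
  have hg1 : 0 < γ - 1 := by linarith
  have hγ0 : 0 < γ := by linarith
  have hG : (P * S * Pᵀ).PosSemidef := by
    simpa using hS.posSemidef.mul_mul_conjTranspose_same P
  have hX : (τ • (P * S * Pᵀ) + T • Ω).PosDef :=
    PosDef.posSemidef_add (hG.smul hτ.le) (hΩ.smul hT)
  have hY : ((τ / γ) • (P * S * Pᵀ) + T • Ω).PosDef :=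
    PosDef.posSemidef_add (hG.smul (by positivity)) (hΩ.smul hT)
  have hA : (Pᵀ * Ω⁻¹ * P).PosSemidef := by
    simpa using hΩ.inv.posSemidef.conjTranspose_mul_mul_same P
  have hB : (γ • S⁻¹ + (τ / T) • (Pᵀ * Ω⁻¹ * P)).PosDef :=
    PosDef.add_posSemidef (hS.inv.smul hγ0) (hA.smul (by positivity))
  have hD : (S⁻¹ + (τ / T) • (Pᵀ * Ω⁻¹ * P)).PosDef :=
    PosDef.add_posSemidef hS.inv (hA.smul (by positivity))
  have uS := (Matrix.isUnit_iff_isUnit_det _).1 hS.isUnit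
  have uΩ := (Matrix.isUnit_iff_isUnit_det _).1 hΩ.isUnit
  have uX := (Matrix.isUnit_iff_isUnit_det _).1 hX.isUnit
  have uY := (Matrix.isUnit_iff_isUnit_det _).1 hY.isUnit
  have uB := (Matrix.isUnit_iff_isUnit_det _).1 hB.isUnit
  have uD := (Matrix.isUnit_iff_isUnit_det _).1 hD.isUnit
  -- key facts about H and Z
  have kH : Pᵀ * (τ • (P * S * Pᵀ) + T • Ω)⁻¹ * P
      * (S * (S⁻¹ + (τ / T) • (Pᵀ * Ω⁻¹ * P))) = T⁻¹ • (Pᵀ * Ω⁻¹ * P) := by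
    have e : P * (S * (S⁻¹ + (τ / T) • (Pᵀ * Ω⁻¹ * P)))
        = T⁻¹ • ((τ • (P * S * Pᵀ) + T • Ω) * (Ω⁻¹ * P)) := by
      rw [mul_add, Matrix.mul_nonsing_inv _ uS, Matrix.mul_add, Matrix.add_mul, smul_add]
      simp only [Matrix.mul_smul, Matrix.smul_mul, smul_smul, Matrix.mul_assoc, mul_one,
        Matrix.mul_nonsing_inv_cancel_left _ _ uΩ, inv_mul_cancel₀ hT.ne', one_smul]
      rw [add_comm, div_eq_inv_mul, Matrix.mul_one]
    rw [Matrix.mul_assoc, e, Matrix.mul_smul, Matrix.mul_assoc,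
      Matrix.nonsing_inv_mul_cancel_left _ _ uX, Matrix.mul_assoc]
  have kZ : Pᵀ * ((τ / γ) • (P * S * Pᵀ) + T • Ω)⁻¹ * P
      - Pᵀ * (τ • (P * S * Pᵀ) + T • Ω)⁻¹ * P
      = (τ - τ / γ) • (Pᵀ * ((τ / γ) • (P * S * Pᵀ) + T • Ω)⁻¹ * P * S *
        (Pᵀ * (τ • (P * S * Pᵀ) + T • Ω)⁻¹ * P)) := by
    have e : (τ - τ / γ) • (P * S * Pᵀ)
      = (τ • (P * S * Pᵀ) + T • Ω) - ((τ / γ) • (P * S * Pᵀ) + T • Ω) := by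
      rw [sub_smul]; abel
    generalize τ • (P * S * Pᵀ) + T • Ω = X at *
    generalize (τ / γ) • (P * S * Pᵀ) + T • Ω = Y at *
    have e2 : Y⁻¹ - X⁻¹ = Y⁻¹ * ((τ - τ / γ) • (P * S * Pᵀ)) * X⁻¹ := by
      rw [e, mul_sub, sub_mul, Matrix.nonsing_inv_mul _ uY,
        Matrix.mul_nonsing_inv_cancel_right _ _ uX, one_mul]
    rw [← Matrix.sub_mul, ← Matrix.mul_sub, e2]
    simp only [Matrix.mul_smul, Matrix.smul_mul, Matrix.mul_assoc]
  have hH : (Pᵀ * (τ • (P * S * Pᵀ) + T • Ω)⁻¹ * P).PosSemidef := by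
    simpa using hX.inv.posSemidef.conjTranspose_mul_mul_same P
  generalize Pᵀ * (τ • (P * S * Pᵀ) + T • Ω)⁻¹ * P = H at *
  generalize Pᵀ * ((τ / γ) • (P * S * Pᵀ) + T • Ω)⁻¹ * P = Z at *
  generalize Pᵀ * Ω⁻¹ * P = A at *
  have hSi : S⁻¹ᴴ = S⁻¹ := hS.inv.isHermitian
  have hτH : S⁻¹ - τ • H = S⁻¹ * (S⁻¹ + (τ / T) • A)⁻¹ * S⁻¹ := by
    have e : (S⁻¹ - τ • H) * (S * (S⁻¹ + (τ / T) • A)) = S⁻¹ := by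
      rw [sub_mul, Matrix.smul_mul, kH, Matrix.nonsing_inv_mul_cancel_left _ _ uS, smul_smul,
        ← div_eq_mul_inv]
      abel
    calc S⁻¹ - τ • H = (S⁻¹ - τ • H) * (S * (S⁻¹ + (τ / T) • A)) *
          ((S⁻¹ + (τ / T) • A)⁻¹ * S⁻¹) := by
          rw [← Matrix.mul_assoc, ← Matrix.mul_assoc,
            Matrix.mul_nonsing_inv_cancel_right _ _ uD, Matrix.mul_nonsing_inv_cancel_right _ _ uS]
      _ = _ := by rw [e, Matrix.mul_assoc]
  have hQ : ((γ / ((γ - 1) * τ)) • S⁻¹ + -H).PosDef := by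
    have e : (γ / ((γ - 1) * τ)) • S⁻¹ + -H
        = (1 / ((γ - 1) * τ)) • S⁻¹ + τ⁻¹ • (S⁻¹ * (S⁻¹ + (τ / T) • A)⁻¹ * S⁻¹) := by
      rw [← hτH, smul_sub, smul_smul, inv_mul_cancel₀ hτ.ne', one_smul, ← sub_eq_add_neg,
        ← add_sub_assoc, ← add_smul]
      congr 2
      field_simp
      ring
    rw [e]
    refine PosDef.add_posSemidef (hS.inv.smul (by positivity)) (PosSemidef.smul ?_ (by positivity))
    have := hD.inv.posSemidef.conjTranspose_mul_mul_same S⁻¹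
    rwa [hSi] at this
  have uQ := (Matrix.isUnit_iff_isUnit_det _).1 hQ.isUnit
  have kB : ((γ - 1) * τ) • (((γ / ((γ - 1) * τ)) • S⁻¹ + -H) * (S * (S⁻¹ + (τ / T) • A)))
      = γ • S⁻¹ + (τ / T) • A := by
    rw [add_mul, Matrix.smul_mul, Matrix.neg_mul, kH, Matrix.nonsing_inv_mul_cancel_left _ _ uS]
    match_scalars <;> field_simp <;> ring
  have hM : ((γ - 1) * (τ / T)) • (A * (γ • S⁻¹ + (τ / T) • A)⁻¹)
      = H * ((γ / ((γ - 1) * τ)) • S⁻¹ + -H)⁻¹ := by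
    have e : ((γ - 1) * (τ / T)) • A
        = H * ((γ / ((γ - 1) * τ)) • S⁻¹ + -H)⁻¹ * (γ • S⁻¹ + (τ / T) • A) := by
      rw [← kB, Matrix.mul_smul, Matrix.mul_assoc, Matrix.nonsing_inv_mul_cancel_left _ _ uQ, kH,
        smul_smul]
      congr 1
      field_simp
    rw [← Matrix.smul_mul, e, Matrix.mul_nonsing_inv_cancel_right _ _ uB]
  have hZ : Z - H = H * ((γ / ((γ - 1) * τ)) • S⁻¹ + -H)⁻¹ * H := by
    have e : (γ / ((γ - 1) * τ)) • H = Z * S * ((γ / ((γ - 1) * τ)) • S⁻¹ + -H) := by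
      rw [mul_add, Matrix.mul_smul, Matrix.mul_nonsing_inv_cancel_right _ _ uS, mul_neg]
      have : Z * S * H = (γ / ((γ - 1) * τ)) • (Z - H) := by
        rw [kZ, smul_smul]
        have : γ / ((γ - 1) * τ) * (τ - τ / γ) = 1 := by field_simp
        rw [this, one_smul]
      rw [this, smul_sub]; abel
    have e2 : (γ / ((γ - 1) * τ)) • (H * ((γ / ((γ - 1) * τ)) • S⁻¹ + -H)⁻¹) = Z * S := by
      rw [← Matrix.smul_mul, e, Matrix.mul_nonsing_inv_cancel_right _ _ uQ]
    have hc : γ / ((γ - 1) * τ) ≠ 0 := by positivity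
    have hcc : τ - τ / γ = (γ / ((γ - 1) * τ))⁻¹ := by field_simp
    rw [kZ, ← e2, Matrix.smul_mul, smul_smul, hcc, inv_mul_cancel₀ hc, one_smul]
  refine ⟨?_, hQ, ?_, ?_⟩
  · rw [hM, Matrix.mul_neg, ← hZ]; abel
  · rw [hM, Matrix.neg_mul, neg_neg]
  · rw [Matrix.neg_mul, Matrix.neg_mul, Matrix.mul_neg, neg_neg, ← hZ]
    abel
end

section
/- Let γ > 1 and define M(t) := (γ−1)(1 − t/T)·PᵀΩ⁻¹P·(γΣ⁻¹ + (1 − t/T)·PᵀΩ⁻¹P)⁻¹. Then for every t ∈ [0, T], the matrix I_N + M(t) is invertible and Σ·(I_N + M(t))⁻¹ = (1/γ)·Σ + (1 − 1/γ)·(Σ⁻¹ + (1 − t/T)·PᵀΩ⁻¹P)⁻¹; equivalently, the optimal dynamic Black–Litterman holding (1/γ)(I_N + M(t))Σ⁻¹·v equals (1/γ)·Σ_DBL(t)⁻¹·v for every v ∈ ℝ^N, where Σ_DBL(t) := (Σ⁻¹ + (1 − t/T)·PᵀΩ⁻¹P)⁻¹ + (1/γ)·(Σ − (Σ⁻¹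 + (1 − t/T)·PᵀΩ⁻¹P)⁻¹). -/
open Matrix
open scoped Matrix

theorem aux_posDef {N K : ℕ} (S : Matrix (Fin N) (Fin N) ℝ) (Ω : Matrix (Fin K) (Fin K) ℝ)
    (P : Matrix (Fin K) (Fin N) ℝ) (hS : S.PosDef) (hΩ : Ω.PosDef) (g s : ℝ) (hg : 0 < g)
    (hs : 0 ≤ s) : IsUnit (g • S⁻¹ + s • (Pᵀ * Ω⁻¹ * P)) := by
  have h1 : (g • S⁻¹).PosDef := hS.inv.smul hg
  have h2 : (Pᵀ * Ω⁻¹ * P).PosSemidef := by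
    have := hΩ.inv.posSemidef.conjTranspose_mul_mul_same P
    rwa [Matrix.conjTranspose_eq_transpose_of_trivial] at this
  exact (h1.add_posSemidef (h2.smul hs)).isUnit

theorem aux_alg {N : ℕ} (S B : Matrix (Fin N) (Fin N) ℝ) (g : ℝ) (hg : 1 < g)
    (hS : IsUnit S) (hC : IsUnit (S⁻¹ + B)) (hD : IsUnit (g • S⁻¹ + B)) :
    IsUnit (1 + (g - 1) • (B * (g • S⁻¹ + B)⁻¹)) ∧
    S * (1 + (g - 1) • (B * (g • S⁻¹ + B)⁻¹))⁻¹ =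
      (1 / g) • S + (1 - 1 / g) • (S⁻¹ + B)⁻¹ := by
  have hg0 : g ≠ 0 := by linarith
  rw [Matrix.isUnit_iff_isUnit_det] at hS hC hD
  have hSS := Matrix.mul_nonsing_inv S hS
  have hCC := Matrix.mul_nonsing_inv _ hC
  have hCC' := Matrix.nonsing_inv_mul _ hC
  have hDD := Matrix.mul_nonsing_inv _ hD
  have hDD' := Matrix.nonsing_inv_mul _ hD
  have hX : 1 + (g - 1) • (B * (g • S⁻¹ + B)⁻¹) = g • ((S⁻¹ + B) * (g • S⁻¹ + B)⁻¹) := by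
    have h : g • (S⁻¹ + B) = (g • S⁻¹ + B) + (g - 1) • B := by module
    rw [← Matrix.smul_mul g, h, Matrix.add_mul, hDD, Matrix.smul_mul]
  have hXY : (1 + (g - 1) • (B * (g • S⁻¹ + B)⁻¹)) *
      ((1 / g) • ((g • S⁻¹ + B) * (S⁻¹ + B)⁻¹)) = 1 := by
    rw [hX, Matrix.smul_mul, Matrix.mul_smul, smul_smul, mul_one_div_cancel hg0, one_smul,
      Matrix.mul_assoc, ← Matrix.mul_assoc _ (g • S⁻¹ + B), hDD', Matrix.one_mul, hCC]
  refine ⟨IsUnit.of_mul_eq_one _ hXY, ?_⟩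
  rw [Matrix.inv_eq_right_inv hXY]
  have h : g • S⁻¹ + B = (S⁻¹ + B) + (g - 1) • S⁻¹ := by module
  rw [h, Matrix.add_mul, hCC, Matrix.smul_mul, Matrix.mul_smul, Matrix.mul_add, Matrix.mul_smul,
    ← Matrix.mul_assoc, hSS, Matrix.mul_one, Matrix.one_mul, smul_add, smul_smul]
  congr 2
  field_simp

/-- For every `t ∈ [0, T]`, `I_N + M(t)` is invertible and
`Σ(I_N + M(t))⁻¹ = (1/γ)Σ + (1 − 1/γ)(Σ⁻¹ + (1 − t/T)PᵀΩ⁻¹P)⁻¹`; equivalently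
the optimal dynamic Black–Litterman holding `(1/γ)(I_N + M(t))Σ⁻¹v` equals
`(1/γ)Σ_DBL(t)⁻¹v` for every `v`. -/
theorem sigma_DBL_identity (N K : ℕ) (hN : 0 < N) (hK : 0 < K)
    (S : Matrix (Fin N) (Fin N) ℝ) (Ω : Matrix (Fin K) (Fin K) ℝ)
    (P : Matrix (Fin K) (Fin N) ℝ) (hS : S.PosDef) (hΩ : Ω.PosDef)
    (T : ℝ) (hT : 0 < T) (γ : ℝ) (hγ : 1 < γ) :
    let M : ℝ → Matrix (Fin N) (Fin N) ℝ := fun t =>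
      ((γ - 1) * (1 - t / T)) •
        (Pᵀ * Ω⁻¹ * P * (γ • S⁻¹ + (1 - t / T) • (Pᵀ * Ω⁻¹ * P))⁻¹)
    let SDBL : ℝ → Matrix (Fin N) (Fin N) ℝ := fun t =>
      (S⁻¹ + (1 - t / T) • (Pᵀ * Ω⁻¹ * P))⁻¹ +
        (1 / γ) • (S - (S⁻¹ + (1 - t / T) • (Pᵀ * Ω⁻¹ * P))⁻¹)
    ∀ t ∈ Set.Icc (0 : ℝ) T,
      IsUnit ((1 : Matrix (Fin N) (Fin N) ℝ) + M t) ∧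
      S * ((1 : Matrix (Fin N) (Fin N) ℝ) + M t)⁻¹ =
        (1 / γ) • S + (1 - 1 / γ) • (S⁻¹ + (1 - t / T) • (Pᵀ * Ω⁻¹ * P))⁻¹ ∧
      ∀ v : Fin N → ℝ,
        (1 / γ) • ((((1 : Matrix (Fin N) (Fin N) ℝ) + M t) * S⁻¹) *ᵥ v) =
          (1 / γ) • ((SDBL t)⁻¹ *ᵥ v) := by
  intro M SDBL t ht
  have hs : 0 ≤ 1 - t / T := by
    have := (div_le_one hT).2 ht.2
    linarith
  have hC := aux_posDef S Ω P hS hΩ 1 (1 - t / T) one_pos hs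
  rw [one_smul] at hC
  have hD := aux_posDef S Ω P hS hΩ γ (1 - t / T) (by linarith) hs
  obtain ⟨h1, h2⟩ := aux_alg S _ γ hγ hS.isUnit hC hD
  have hM : M t = (γ - 1) • ((1 - t / T) • (Pᵀ * Ω⁻¹ * P) *
      (γ • S⁻¹ + (1 - t / T) • (Pᵀ * Ω⁻¹ * P))⁻¹) := by
    simp only [M]
    rw [Matrix.smul_mul, smul_smul]
  rw [← hM] at h1 h2
  refine ⟨h1, h2, fun v => ?_⟩
  have h3 : SDBL t = S * (1 + M t)⁻¹ := by
    rw [h2]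
    simp only [SDBL]
    module
  rw [h3, Matrix.mul_inv_rev,
    Matrix.nonsing_inv_nonsing_inv _ ((Matrix.isUnit_iff_isUnit_det _).1 h1)]
end

section
/- Let γ > 0 and define Q : ℝ → Matrix (Fin K) (Fin K) ℝ by Q(t) := (((T−t)/γ)·PΣPᵀ + Ω)⁻¹. Then for every t ∈ [0, T], the map Q has derivative (1/γ)·Q(t)·PΣPᵀ·Q(t) at t (in the sense of HasDerivAt); that is, Q solves the matrix Riccati equation Q′(t) − (1/γ)·Q(t)·PΣPᵀ·Q(t) = 0 with Q(T) = Ω⁻¹. -/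
open Matrix
open scoped Matrix

attribute [local instance] Matrix.normedAddCommGroup Matrix.normedSpace

theorem aux_cont {K : ℕ} (M Ω : Matrix (Fin K) (Fin K) ℝ) (T γ t : ℝ)
    (hdet : (((T - t) / γ) • M + Ω).det ≠ 0) :
    ContinuousAt (fun s : ℝ => (((T - s) / γ) • M + Ω)⁻¹) t := by
  have hcA : Continuous (fun s : ℝ => ((T - s) / γ) • M + Ω) := by fun_prop
  have hi : ContinuousAt (fun B : Matrix (Fin K) (Fin K) ℝ => B⁻¹)
      (((T - t) / γ) • M + Ω) := by
    apply continuousAt_matrix_inv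
    rw [Ring.inverse_eq_inv']
    exact continuousAt_inv₀ hdet
  exact ContinuousAt.comp_of_eq hi hcA.continuousAt rfl

/-- `Q(t) := (((T−t)/γ)·PΣPᵀ + Ω)⁻¹` solves the matrix Riccati equation
`Q′(t) − (1/γ)·Q(t)·PΣPᵀ·Q(t) = 0` on `[0, T]` with `Q(T) = Ω⁻¹`. -/
theorem Q_riccati (N K : ℕ) (hN : 0 < N) (hK : 0 < K)
    (S : Matrix (Fin N) (Fin N) ℝ) (Ω : Matrix (Fin K) (Fin K) ℝ)
    (P : Matrix (Fin K) (Fin N) ℝ) (hS : S.PosDef) (hΩ : Ω.PosDef)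
    (T : ℝ) (hT : 0 < T) (γ : ℝ) (hγ : 0 < γ) :
    let Q : ℝ → Matrix (Fin K) (Fin K) ℝ :=
      fun t => (((T - t) / γ) • (P * S * Pᵀ) + Ω)⁻¹
    (∀ t ∈ Set.Icc (0 : ℝ) T,
        HasDerivAt Q ((1 / γ) • (Q t * (P * S * Pᵀ) * Q t)) t) ∧
      Q T = Ω⁻¹ := by
  have hM : (P * S * Pᵀ).PosSemidef := by
    have h := hS.posSemidef.mul_mul_conjTranspose_same P
    simpa [Matrix.conjTranspose_eq_transpose_of_trivial] using h
  set M := P * S * Pᵀ with hMdef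
  clear_value M
  intro Q
  refine ⟨?_, by simp [Q]⟩
  intro t ht
  have hA : (((T - t) / γ) • M + Ω).PosDef :=
    Matrix.PosDef.posSemidef_add (hM.smul (div_nonneg (sub_nonneg.2 ht.2) hγ.le)) hΩ
  have hdet : (((T - t) / γ) • M + Ω).det ≠ 0 := hA.det_pos.ne'
  have hcA : Continuous (fun s : ℝ => ((T - s) / γ) • M + Ω) := by fun_prop
  have hcQ : ContinuousAt Q t := by
    exact aux_cont M Ω T γ t hdet
  have hev : ∀ᶠ s in nhds t, (((T - s) / γ) • M + Ω).det ≠ 0 :=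
    (hcA.matrix_det.continuousAt).eventually_ne hdet
  refine hasDerivAt_iff_tendsto_slope.2 ?_
  have hlim : Filter.Tendsto (fun s => (1 / γ) • (Q s * M * Q t)) (nhdsWithin t {t}ᶜ)
      (nhds ((1 / γ) • (Q t * M * Q t))) := by
    have hc : ContinuousAt (fun s => (1 / γ) • (Q s * M * Q t)) t :=
      ((hcQ.mul continuousAt_const).mul continuousAt_const).const_smul (1 / γ)
    exact hc.tendsto.mono_left nhdsWithin_le_nhds
  refine hlim.congr' ?_
  filter_upwards [nhdsWithin_le_nhds hev, self_mem_nhdsWithin] with s hs hne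
  have hne' : s - t ≠ 0 := sub_ne_zero.2 hne
  have key : Q s - Q t = ((s - t) / γ) • (Q s * M * Q t) := by
    have h1 : Q s * (((T - s) / γ) • M + Ω) = 1 :=
      Matrix.nonsing_inv_mul _ (isUnit_iff_ne_zero.2 hs)
    have h2 : (((T - t) / γ) • M + Ω) * Q t = 1 :=
      Matrix.mul_nonsing_inv _ (isUnit_iff_ne_zero.2 hdet)
    have h3 : ((s - t) / γ) • M = (((T - t) / γ) • M + Ω) - (((T - s) / γ) • M + Ω) := by
      rw [add_sub_add_right_eq_sub, ← sub_smul]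
      congr 1
      ring
    calc Q s - Q t = Q s * ((((T - t) / γ) • M + Ω) * Q t)
          - (Q s * (((T - s) / γ) • M + Ω)) * Q t := by rw [h1, h2, mul_one, one_mul]
      _ = Q s * (((s - t) / γ) • M) * Q t := by rw [h3]; noncomm_ring
      _ = _ := by rw [Matrix.mul_smul, Matrix.smul_mul]
  rw [slope_def_module, key, smul_smul]
  congr 1
  field_simp
end

section
/- Let γ > 1 and define η̄(t) := −((T−t)·PΣPᵀ + Ω)⁻¹, C(t) := η̄(t) + (((T−t)/γ)·PΣPᵀ + Ω)⁻¹, and M̄(t) := −(γ−1)(T−t)·Ω⁻¹P·(γΣ⁻¹ + (T−t)·PᵀΩ⁻¹P)⁻¹. Then for every t ∈ [0, T], C(t) = M̄(t)·Pᵀ·η̄(t). -/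
open Matrix
open scoped Matrix

/-- With `η̄(t) := −((T−t)PΣPᵀ + Ω)⁻¹`,
`C(t) := η̄(t) + (((T−t)/γ)PΣPᵀ + Ω)⁻¹` and
`M̄(t) := −(γ−1)(T−t)·Ω⁻¹P(γΣ⁻¹ + (T−t)PᵀΩ⁻¹P)⁻¹`, for every `t ∈ [0, T]` we
have `C(t) = M̄(t)·Pᵀ·η̄(t)`. -/
theorem C_eq_Mbar_Pt_etabar (N K : ℕ) (hN : 0 < N) (hK : 0 < K)
    (S : Matrix (Fin N) (Fin N) ℝ) (Ω : Matrix (Fin K) (Fin K) ℝ)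
    (P : Matrix (Fin K) (Fin N) ℝ) (hS : S.PosDef) (hΩ : Ω.PosDef)
    (T : ℝ) (hT : 0 < T) (γ : ℝ) (hγ : 1 < γ) :
    let ηbar : ℝ → Matrix (Fin K) (Fin K) ℝ :=
      fun t => -((T - t) • (P * S * Pᵀ) + Ω)⁻¹
    let C : ℝ → Matrix (Fin K) (Fin K) ℝ :=
      fun t => ηbar t + (((T - t) / γ) • (P * S * Pᵀ) + Ω)⁻¹
    let Mbar : ℝ → Matrix (Fin K) (Fin N) ℝ := fun t =>
      -(((γ - 1) * (T - t)) •
        (Ω⁻¹ * P * (γ • S⁻¹ + (T - t) • (Pᵀ * Ω⁻¹ * P))⁻¹))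
    ∀ t ∈ Set.Icc (0 : ℝ) T, C t = Mbar t * Pᵀ * ηbar t := by
  intro ηbar C Mbar t ht
  have hs : 0 ≤ T - t := sub_nonneg.mpr ht.2
  have hγ0 : 0 < γ := by linarith
  have hγne : γ ≠ 0 := hγ0.ne'
  simp only [C, Mbar, ηbar]
  clear_value ηbar C Mbar
  generalize T - t = s at hs
  have hQ : (P * S * Pᵀ).PosSemidef := by
    have := hS.posSemidef.mul_mul_conjTranspose_same P
    rwa [conjTranspose_eq_transpose_of_trivial] at this
  have hR : (Pᵀ * Ω⁻¹ * P).PosSemidef := by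
    have := hΩ.inv.posSemidef.conjTranspose_mul_mul_same P
    rwa [conjTranspose_eq_transpose_of_trivial] at this
  have hA : (s • (P * S * Pᵀ) + Ω).PosDef := PosDef.posSemidef_add (hQ.smul hs) hΩ
  have hB : ((s / γ) • (P * S * Pᵀ) + Ω).PosDef :=
    PosDef.posSemidef_add (hQ.smul (div_nonneg hs hγ0.le)) hΩ
  have hD : (γ • S⁻¹ + s • (Pᵀ * Ω⁻¹ * P)).PosDef :=
    PosDef.add_posSemidef (hS.inv.smul hγ0) (hR.smul hs)
  have uA := (Matrix.isUnit_iff_isUnit_det _).mp hA.isUnit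
  have uB := (Matrix.isUnit_iff_isUnit_det _).mp hB.isUnit
  have uD := (Matrix.isUnit_iff_isUnit_det _).mp hD.isUnit
  have uS := (Matrix.isUnit_iff_isUnit_det _).mp hS.isUnit
  have uΩ := (Matrix.isUnit_iff_isUnit_det _).mp hΩ.isUnit
  have key : ((s / γ) • (P * S * Pᵀ) + Ω) * (γ • (Ω⁻¹ * P))
      = P * S * (γ • S⁻¹ + s • (Pᵀ * Ω⁻¹ * P)) := by
    have h1 : Ω * (Ω⁻¹ * P) = P := Matrix.mul_nonsing_inv_cancel_left _ _ uΩ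
    have h2 : P * S * S⁻¹ = P := Matrix.mul_nonsing_inv_cancel_right _ _ uS
    rw [Matrix.add_mul, Matrix.mul_add, Matrix.mul_smul, Matrix.mul_smul, Matrix.mul_smul,
      Matrix.mul_smul, h1, h2, Matrix.smul_mul, smul_smul, mul_div_cancel₀ _ hγne, add_comm]
    simp only [Matrix.mul_assoc]
  have hdiff : s • (P * S * Pᵀ) + Ω
      = ((s / γ) • (P * S * Pᵀ) + Ω) + (s - s / γ) • (P * S * Pᵀ) := by
    rw [sub_smul]; abel
  have hc : (γ - 1) * s = γ * (s - s / γ) := by field_simp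
  generalize hAe : s • (P * S * Pᵀ) + Ω = A at *
  generalize hBe : (s / γ) • (P * S * Pᵀ) + Ω = B at *
  generalize hDe : γ • S⁻¹ + s • (Pᵀ * Ω⁻¹ * P) = D at *
  have push : γ • (Ω⁻¹ * P * D⁻¹) = B⁻¹ * (P * S) := by
    have h := congrArg (fun X => B⁻¹ * X * D⁻¹) key
    beta_reduce at h
    rw [Matrix.nonsing_inv_mul_cancel_left _ _ uB, Matrix.mul_assoc B⁻¹,
      Matrix.mul_nonsing_inv_cancel_right _ _ uD, Matrix.smul_mul] at h
    exact h
  have e1 : ((γ - 1) * s) • (Ω⁻¹ * P * D⁻¹) = (s - s / γ) • (B⁻¹ * (P * S)) := by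
    rw [← push, smul_smul, hc, mul_comm]
  rw [e1]
  have e2 : B⁻¹ = B⁻¹ * A * A⁻¹ := (Matrix.mul_nonsing_inv_cancel_right _ _ uA).symm
  have e3 : B⁻¹ * A = 1 + (s - s / γ) • (B⁻¹ * (P * S) * Pᵀ) := by
    rw [hdiff, Matrix.mul_add, Matrix.nonsing_inv_mul _ uB, Matrix.mul_smul,
      Matrix.mul_assoc B⁻¹]
  have e4 : B⁻¹ = A⁻¹ + (s - s / γ) • (B⁻¹ * (P * S) * Pᵀ) * A⁻¹ := by
    rw [e3, Matrix.add_mul, Matrix.one_mul] at e2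
    exact e2
  rw [Matrix.neg_mul, Matrix.neg_mul, Matrix.mul_neg, neg_neg, Matrix.smul_mul,
    neg_add_eq_iff_eq_add]
  exact e4
end
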